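/- Let M be a compact metric space, f a continuous flow on M, ν an f-invariant ergodic Borel probability measure on M, γ : M → (0,∞) continuous, and g the time change of f with speed multiplier γ. Then for every continuous function ξ : M → ℝ, for ν-almost every x ∈ M, lim_{t→∞} (1/t) ∫₀^t ξ(g^s(x)) ds = (∫_M ξ·γ^{−1} dν) / (∫_M γ^{−1} dν) = ∫_M ξ dν^γ. -/

import Mathlib

open MeasureTheory intervalIntegral Filter Topology

/-- The additive cocycle over the flow `g` generated by `γ`:
`τ(t,x) = ∫₀^t γ(g^s x) ds`. -/
noncomputable def addCocycle {M : Type*} [TopologicalSpace M] (g : Flow ℝ M) (γ : M → ℝ)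
    (t : ℝ) (x : M) : ℝ :=
  ∫ s in (0 : ℝ)..t, γ (g s x)

/-- The flow `g` is a time change of `f` with speed multiplier `γ`. -/
def IsTimeChange {M : Type*} [TopologicalSpace M] (f g : Flow ℝ M) (γ : M → ℝ) : Prop :=
  ∀ t x, g t x = f (addCocycle g γ t x) x

/-- The measure `ν^γ`, with Radon–Nikodym derivative
`dν^γ/dν = γ⁻¹ · (∫ γ⁻¹ dν)⁻¹`. -/
noncomputable def nuGamma {M : Type*} [MeasurableSpace M] (ν : Measure M) (γ : M → ℝ) :
    Measure M :=
  ν.withDensity fun x => ENNReal.ofReal ((γ x)⁻¹ / ∫ y, (γ y)⁻¹ ∂ν)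

section AddCocycle

variable {M : Type*} [TopologicalSpace M] (f : Flow ℝ M) {h : M → ℝ}

theorem continuous_comp_flow (hh : Continuous h) (x : M) : Continuous fun s : ℝ => h (f s x) :=
  hh.comp (f.continuous continuous_id continuous_const)

theorem continuous_addCocycle (hh : Continuous h) (t : ℝ) :
    Continuous fun x => addCocycle f h t x :=
  intervalIntegral.continuous_parametric_intervalIntegral_of_continuous'
    (f := fun x s => h (f s x)) (hh.comp (f.continuous continuous_snd continuous_fst)) 0 t

@[simp]
theorem addCocycle_zero (h : M → ℝ) (x : M) : addCocycle f h 0 x = 0 := by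
  simp [addCocycle]

theorem addCocycle_add (hh : Continuous h) (s t : ℝ) (x : M) :
    addCocycle f h (s + t) x = addCocycle f h s x + addCocycle f h t (f s x) := by
  have hc := continuous_comp_flow f hh x
  have key : ∫ u in (0 : ℝ)..t, h (f u (f s x)) = ∫ u in s..s + t, h (f u x) := by
    simp_rw [← f.map_add]
    rw [intervalIntegral.integral_comp_add_right (fun u => h (f u x)), zero_add, add_comm]
  rw [addCocycle, addCocycle, addCocycle, key,
    intervalIntegral.integral_add_adjacent_intervals] <;> exact hc.intervalIntegrable _ _

theorem abs_addCocycle_le {C : ℝ} (hC : ∀ x, |h x| ≤ C) (t : ℝ) (x : M) :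
    |addCocycle f h t x| ≤ C * |t| := by
  simpa [addCocycle] using intervalIntegral.norm_integral_le_of_norm_le_const
    (a := 0) (b := t) (f := fun s => h (f s x)) (C := C) fun s _ => hC _

theorem hasDerivAt_addCocycle (hh : Continuous h) (t : ℝ) (x : M) :
    HasDerivAt (fun u => addCocycle f h u x) (h (f t x)) t :=
  ((continuous_comp_flow f hh x).integral_hasStrictDerivAt 0 t).hasDerivAt

theorem addCocycle_sub_const (hh : Continuous h) (a t : ℝ) (x : M) :
    addCocycle f (fun y => h y - a) t x = addCocycle f h t x - a * t := by
  rw [addCocycle, intervalIntegral.integral_sub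
    ((continuous_comp_flow f hh x).intervalIntegrable _ _) (by simp)]
  simp [addCocycle, mul_comm]

theorem addCocycle_neg (h : M → ℝ) (t : ℝ) (x : M) :
    addCocycle f (fun y => -h y) t x = -addCocycle f h t x := by
  simp [addCocycle]

/-- The running maximum `max (0, A₁, …, Aₙ)` of the integer-time values of the cocycle. -/
noncomputable def runningMax (h : M → ℝ) : ℕ → M → ℝ
  | 0, _ => 0
  | n + 1, x => max 0 (addCocycle f h 1 x + runningMax h n (f 1 x))

theorem continuous_runningMax (hh : Continuous h) (n : ℕ) : Continuous (runningMax f h n) := by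
  induction n with
  | zero => exact continuous_const
  | succ n ih =>
    exact continuous_const.max
      ((continuous_addCocycle f hh 1).add (ih.comp (f.continuous_toFun 1)))

theorem runningMax_nonneg (h : M → ℝ) (n : ℕ) (x : M) : 0 ≤ runningMax f h n x := by
  cases n with
  | zero => exact le_rfl
  | succ n => exact le_max_left _ _

theorem runningMax_le_succ (h : M → ℝ) (n : ℕ) (x : M) :
    runningMax f h n x ≤ runningMax f h (n + 1) x := by
  induction n generalizing x with
  | zero => exact runningMax_nonneg f h 1 x
  | succ n ih =>
    rw [runningMax, runningMax]
    gcongr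
    exact ih _

theorem addCocycle_le_runningMax (hh : Continuous h) (n : ℕ) (x : M) :
    addCocycle f h n x ≤ runningMax f h n x := by
  induction n generalizing x with
  | zero => simp [runningMax]
  | succ n ih =>
    rw [Nat.cast_succ, add_comm (n : ℝ), addCocycle_add f hh, runningMax]
    exact le_max_of_le_right (by gcongr; exact ih _)

/-- The set of points along whose orbit the integer-time cocycle is unbounded above. -/
def unboundedSet (h : M → ℝ) : Set M :=
  ⋂ C : ℕ, ⋃ n : ℕ, {x | (C : ℝ) < addCocycle f h n x}

theorem mem_unboundedSet {x : M} :
    x ∈ unboundedSet f h ↔ ∀ C : ℝ, ∃ n : ℕ, C < addCocycle f h n x := by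
  simp only [unboundedSet, Set.mem_iInter, Set.mem_iUnion, Set.mem_ofPred_eq]
  refine ⟨fun H C => ?_, fun H C => H C⟩
  obtain ⟨k, hk⟩ := exists_nat_ge C
  obtain ⟨n, hn⟩ := H k
  exact ⟨n, hk.trans_lt hn⟩

theorem flow_mem_unboundedSet (hh : Continuous h) {C : ℝ} (hC : ∀ x, |h x| ≤ C) (r : ℝ) {x : M}
    (hx : x ∈ unboundedSet f h) : f r x ∈ unboundedSet f h := by
  rw [mem_unboundedSet] at hx ⊢
  intro D
  obtain ⟨n, hn⟩ := hx (D + C * |r| + C * |r|)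
  refine ⟨n, ?_⟩
  have h1 := addCocycle_add f hh r n x
  rw [add_comm, addCocycle_add f hh] at h1
  have h2 := abs_le.mp (abs_addCocycle_le f hC r x)
  have h3 := abs_le.mp (abs_addCocycle_le f hC r (f n x))
  linarith

theorem image_unboundedSet (hh : Continuous h) {C : ℝ} (hC : ∀ x, |h x| ≤ C) (r : ℝ) :
    f r '' unboundedSet f h = unboundedSet f h := by
  apply Set.Subset.antisymm
  · rintro _ ⟨x, hx, rfl⟩
    exact flow_mem_unboundedSet f hh hC r hx
  · intro x hx
    refine ⟨f (-r) x, flow_mem_unboundedSet f hh hC _ hx, ?_⟩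
    rw [← f.map_add, add_neg_cancel, f.map_zero_apply]

theorem measurableSet_unboundedSet [MeasurableSpace M] [OpensMeasurableSpace M]
    (hh : Continuous h) : MeasurableSet (unboundedSet f h) :=
  .iInter fun _ => .iUnion fun n =>
    (isOpen_lt continuous_const (continuous_addCocycle f hh n)).measurableSet

end AddCocycle

section Birkhoff

theorem integral_comp_flow {M : Type*} [MetricSpace M] [MeasurableSpace M] [BorelSpace M]
    (f : Flow ℝ M) (ν : Measure M) (hinv : ∀ t : ℝ, MeasurePreserving (f t) ν ν)
    {h : M → ℝ} (hh : Continuous h) (t : ℝ) : ∫ x, h (f t x) ∂ν = ∫ x, h x ∂ν := by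
  rw [← integral_map (hinv t).aemeasurable hh.aestronglyMeasurable, (hinv t).map_eq]

variable {M : Type*} [MetricSpace M] [CompactSpace M] [MeasurableSpace M] [BorelSpace M]
  (f : Flow ℝ M) (ν : Measure M) [IsProbabilityMeasure ν]

theorem integrable_of_continuous {h : M → ℝ} (hh : Continuous h) : Integrable h ν :=
  hh.integrable_of_hasCompactSupport (HasCompactSupport.of_compactSpace h)

theorem integral_addCocycle (hinv : ∀ t : ℝ, MeasurePreserving (f t) ν ν)
    {h : M → ℝ} (hh : Continuous h) (t : ℝ) :
    ∫ x, addCocycle f h t x ∂ν = t * ∫ x, h x ∂ν := by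
  obtain ⟨C, hC⟩ := isCompact_univ.exists_bound_of_continuousOn hh.continuousOn
  have hc : Continuous (Function.uncurry fun (s : ℝ) (x : M) => h (f s x)) :=
    hh.comp f.cont'
  have : IsFiniteMeasure (volume.restrict (Set.uIoc 0 t)) := ⟨by simp [Set.uIoc]⟩
  have hi : Integrable (Function.uncurry fun (s : ℝ) (x : M) => h (f s x))
      ((volume.restrict (Set.uIoc 0 t)).prod ν) :=
    .of_bound hc.aestronglyMeasurable C (.of_forall fun p => hC _ (Set.mem_univ _))
  simp only [addCocycle]
  rw [← intervalIntegral_integral_swap hi]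
  simp [integral_comp_flow f ν hinv hh]

/-- Maximal ergodic argument: a function of negative mean has cocycle bounded above in positive
time, almost everywhere. -/
theorem ae_addCocycle_le_of_integral_neg (hinv : ∀ t : ℝ, MeasurePreserving (f t) ν ν)
    (herg : ∀ J : Set M, MeasurableSet J → (∀ t : ℝ, f t '' J = J) → ν J = 0 ∨ ν J = 1)
    {h : M → ℝ} (hh : Continuous h) (hneg : ∫ x, h x ∂ν < 0) :
    ∀ᵐ x ∂ν, ∃ D, ∀ t : ℝ, 0 ≤ t → addCocycle f h t x ≤ D := by
  obtain ⟨C, hC⟩ := isCompact_univ.exists_bound_of_continuousOn hh.continuousOn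
  replace hC : ∀ x, |h x| ≤ C := fun x => hC x (Set.mem_univ x)
  have hE := measurableSet_unboundedSet f hh
  have hnull : ν (unboundedSet f h) = 0 := by
    refine (herg _ hE (image_unboundedSet f hh hC)).resolve_right fun h1 => ?_
    have hae : ∀ᵐ x ∂ν, x ∈ unboundedSet f h := (prob_compl_eq_zero_iff hE).mpr h1
    have hM := continuous_runningMax f hh
    have hMT (n : ℕ) : Continuous fun x => runningMax f h n (f 1 x) :=
      (hM n).comp (f.continuous_toFun 1)
    have hlim : Tendsto
        (fun n => ∫ x, runningMax f h (n + 1) x - runningMax f h n (f 1 x) ∂ν) atTop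
        (𝓝 (∫ x, addCocycle f h 1 x ∂ν)) := by
      refine tendsto_integral_of_dominated_convergence (fun x => |addCocycle f h 1 x|)
        (fun n => ((hM _).sub (hMT n)).aestronglyMeasurable)
        (integrable_of_continuous ν (continuous_addCocycle f hh 1).abs) ?_ ?_
      · refine fun n => .of_forall fun x => ?_
        have := runningMax_nonneg f h n (f 1 x)
        rw [runningMax, Real.norm_eq_abs]
        rcases max_cases 0 (addCocycle f h 1 x + runningMax f h n (f 1 x)) with H | H <;>
          rw [H.1] <;> grind
      · filter_upwards [hae] with x hx
        obtain ⟨N, hN⟩ := (mem_unboundedSet f).mp (flow_mem_unboundedSet f hh hC 1 hx)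
          (-addCocycle f h 1 x)
        refine tendsto_const_nhds.congr' ?_
        filter_upwards [eventually_ge_atTop N] with n hn
        have hmono := monotone_nat_of_le_succ (fun n => runningMax_le_succ f h n (f 1 x)) hn
        have hle := addCocycle_le_runningMax f hh N (f 1 x)
        rw [runningMax, max_eq_right (by linarith)]
        ring
    have hnonneg (n : ℕ) :
        0 ≤ ∫ x, runningMax f h (n + 1) x - runningMax f h n (f 1 x) ∂ν := by
      rw [integral_sub (integrable_of_continuous ν (hM _)) (integrable_of_continuous ν (hMT n)),
        integral_comp_flow f ν hinv (hM n), sub_nonneg]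
      exact integral_mono (integrable_of_continuous ν (hM _)) (integrable_of_continuous ν (hM _))
        (runningMax_le_succ f h n)
    have := ge_of_tendsto' hlim hnonneg
    rw [integral_addCocycle f ν hinv hh] at this
    linarith
  have hae : ∀ᵐ x ∂ν, x ∉ unboundedSet f h := measure_eq_zero_iff_ae_notMem.mp hnull
  filter_upwards [hae] with x hx
  rw [mem_unboundedSet] at hx
  push Not at hx
  obtain ⟨D, hD⟩ := hx
  refine ⟨D + C, fun t ht => ?_⟩
  have h1 := addCocycle_add f hh ⌊t⌋₊ (t - ⌊t⌋₊) x
  rw [add_sub_cancel] at h1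
  have h2 := (le_abs_self _).trans (abs_addCocycle_le f hC (t - ⌊t⌋₊) (f ⌊t⌋₊ x))
  have h3 := Nat.floor_le ht
  have h4 := Nat.lt_floor_add_one t
  have h5 : C * |t - ⌊t⌋₊| ≤ C * 1 :=
    mul_le_mul_of_nonneg_left (abs_le.mpr ⟨by linarith, by linarith⟩)
      ((abs_nonneg _).trans (hC x))
  linarith [hD ⌊t⌋₊]

theorem ae_eventually_addCocycle_lt (hinv : ∀ t : ℝ, MeasurePreserving (f t) ν ν)
    (herg : ∀ J : Set M, MeasurableSet J → (∀ t : ℝ, f t '' J = J) → ν J = 0 ∨ ν J = 1)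
    {h : M → ℝ} (hh : Continuous h) :
    ∀ᵐ x ∂ν, ∀ a, ∫ y, h y ∂ν < a → ∀ᶠ t : ℝ in atTop, addCocycle f h t x / t < a := by
  have key (q : ℚ) : ∀ᵐ x ∂ν, ∫ y, h y ∂ν < q →
      ∃ D, ∀ t : ℝ, 0 ≤ t → addCocycle f h t x - q * t ≤ D := by
    by_cases hq : ∫ y, h y ∂ν < q
    · have hneg : ∫ y, (h y - q) ∂ν < 0 := by
        rw [integral_sub (integrable_of_continuous ν hh) (integrable_const _)]
        simpa using hq
      filter_upwards [ae_addCocycle_le_of_integral_neg f ν hinv herg (h := fun y => h y - q)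
        (hh.sub continuous_const) hneg] with x hx _
      simpa only [addCocycle_sub_const f hh] using hx
    · exact .of_forall fun x hx => absurd hx hq
  filter_upwards [ae_all_iff.mpr key] with x hx a ha
  obtain ⟨q, hq, hqa⟩ := exists_rat_btwn ha
  obtain ⟨D, hD⟩ := hx q hq
  filter_upwards [eventually_gt_atTop 0, eventually_gt_atTop (D / (a - q))] with t ht htD
  rw [div_lt_iff₀ (sub_pos.mpr hqa)] at htD
  rw [div_lt_iff₀ ht]
  linarith [hD t ht.le]

/-- Birkhoff's pointwise ergodic theorem for an ergodic continuous flow and a continuous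
observable. -/
theorem ae_tendsto_addCocycle_div (hinv : ∀ t : ℝ, MeasurePreserving (f t) ν ν)
    (herg : ∀ J : Set M, MeasurableSet J → (∀ t : ℝ, f t '' J = J) → ν J = 0 ∨ ν J = 1)
    {h : M → ℝ} (hh : Continuous h) :
    ∀ᵐ x ∂ν, Tendsto (fun t : ℝ => addCocycle f h t x / t) atTop (𝓝 (∫ y, h y ∂ν)) := by
  filter_upwards [ae_eventually_addCocycle_lt f ν hinv herg hh,
    ae_eventually_addCocycle_lt f ν hinv herg (h := fun y => -h y) hh.neg] with x hx hx'
  refine tendsto_order.mpr ⟨fun a ha => ?_, hx⟩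
  filter_upwards [hx' (-a) (by rw [MeasureTheory.integral_neg]; exact neg_lt_neg ha)] with t ht
  rw [addCocycle_neg, neg_div] at ht
  exact neg_lt_neg_iff.mp ht

end Birkhoff

section TimeChange

variable {M : Type*} [TopologicalSpace M] {f g : Flow ℝ M} {γ : M → ℝ}

theorem IsTimeChange.addCocycle_eq (hg : IsTimeChange f g γ) (hγc : Continuous γ)
    (hγpos : ∀ x, 0 < γ x) {ξ : M → ℝ} (hξ : Continuous ξ) (t : ℝ) (x : M) :
    addCocycle g ξ t x = addCocycle f (fun y => ξ y * (γ y)⁻¹) (addCocycle g γ t x) x := by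
  have hc : Continuous fun y => ξ y * (γ y)⁻¹ := hξ.mul (hγc.inv₀ fun y => (hγpos y).ne')
  have := intervalIntegral.integral_comp_mul_deriv (a := 0) (b := t)
    (fun s _ => hasDerivAt_addCocycle g hγc s x)
    (continuous_comp_flow g hγc x).continuousOn (continuous_comp_flow f hc x)
  rw [addCocycle_zero] at this
  rw [addCocycle, addCocycle, ← this]
  refine intervalIntegral.integral_congr fun s _ => ?_
  simp only [Function.comp_apply, ← hg s x]
  rw [inv_mul_cancel_right₀ (hγpos _).ne']

theorem tendsto_addCocycle_atTop [CompactSpace M] (g : Flow ℝ M) (hγc : Continuous γ)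
    (hγpos : ∀ x, 0 < γ x) (x : M) : Tendsto (fun t => addCocycle g γ t x) atTop atTop := by
  obtain ⟨y, -, hy⟩ := isCompact_univ.exists_isMinOn ⟨x, Set.mem_univ x⟩ hγc.continuousOn
  refine tendsto_atTop_mono' _ ?_ (tendsto_id.const_mul_atTop (hγpos y))
  filter_upwards [eventually_ge_atTop 0] with t ht
  have := intervalIntegral.integral_mono_on (f := fun _ => γ y) ht (by simp)
    ((continuous_comp_flow g hγc x).intervalIntegrable (μ := volume) 0 t)
    fun s _ => hy (Set.mem_univ _)
  simpa [addCocycle, mul_comm] using this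

end TimeChange

theorem integral_nuGamma {M : Type*} [MeasurableSpace M] (ν : Measure M) {γ : M → ℝ}
    (hγ : Measurable γ) (hγpos : ∀ x, 0 < γ x) (ξ : M → ℝ) :
    ∫ y, ξ y ∂(nuGamma ν γ) = (∫ y, ξ y * (γ y)⁻¹ ∂ν) / ∫ y, (γ y)⁻¹ ∂ν := by
  have hI : 0 ≤ ∫ y, (γ y)⁻¹ ∂ν := integral_nonneg fun y => (inv_pos.mpr (hγpos y)).le
  rw [nuGamma, integral_withDensity_eq_integral_toReal_smul (by fun_prop)
    (.of_forall fun _ => ENNReal.ofReal_lt_top), ← MeasureTheory.integral_div]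
  congr 1 with y
  rw [ENNReal.toReal_ofReal (div_nonneg (inv_pos.mpr (hγpos y)).le hI), smul_eq_mul]
  ring

/-- Birkhoff averages of the time-changed flow: if `ν` is an `f`-invariant
ergodic Borel probability measure and `g` is the time change of `f` with speed multiplier
`γ`, then for every continuous `ξ : M → ℝ`, for `ν`-a.e. `x`,
`(1/t)∫₀^t ξ(g^s x) ds → (∫ ξ γ⁻¹ dν)/(∫ γ⁻¹ dν) = ∫ ξ dν^γ` as `t → ∞`. -/
theorem stmt5 {M : Type*} [MetricSpace M] [CompactSpace M]
    [MeasurableSpace M] [BorelSpace M]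
    (f g : Flow ℝ M) (γ : M → ℝ) (hγc : Continuous γ) (hγpos : ∀ x, 0 < γ x)
    (hg : IsTimeChange f g γ)
    (ν : Measure M) [IsProbabilityMeasure ν]
    (hinv : ∀ t : ℝ, MeasurePreserving (f t) ν ν)
    (herg : ∀ J : Set M, MeasurableSet J → (∀ t : ℝ, f t '' J = J) → ν J = 0 ∨ ν J = 1)
    (ξ : M → ℝ) (hξ : Continuous ξ) :
    (∀ᵐ x ∂ν, Tendsto (fun t : ℝ => (1 / t) * ∫ s in (0 : ℝ)..t, ξ (g s x)) atTop
      (𝓝 ((∫ y, ξ y * (γ y)⁻¹ ∂ν) / ∫ y, (γ y)⁻¹ ∂ν))) ∧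
    (∫ y, ξ y * (γ y)⁻¹ ∂ν) / (∫ y, (γ y)⁻¹ ∂ν) = ∫ y, ξ y ∂(nuGamma ν γ) := by
  have hγi : Continuous fun y => (γ y)⁻¹ := hγc.inv₀ fun y => (hγpos y).ne'
  refine ⟨?_, (integral_nuGamma ν hγc.measurable hγpos ξ).symm⟩
  have hpos : 0 < ∫ y, (γ y)⁻¹ ∂ν := by
    have hsupp : Function.support (fun y => (γ y)⁻¹) = Set.univ :=
      Set.eq_univ_of_forall fun y => (inv_pos.mpr (hγpos y)).ne'
    rw [integral_pos_iff_support_of_nonneg (fun y => (inv_pos.mpr (hγpos y)).le)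
      (integrable_of_continuous ν hγi), hsupp]
    simp
  filter_upwards [ae_tendsto_addCocycle_div f ν hinv herg (h := fun y => ξ y * (γ y)⁻¹) (hξ.mul hγi),
    ae_tendsto_addCocycle_div f ν hinv herg hγi] with x hx hx'
  have hτ := tendsto_addCocycle_atTop g hγc hγpos x
  refine ((hx.div hx' hpos.ne').comp hτ).congr' ?_
  filter_upwards [hτ.eventually_gt_atTop 0] with t ht
  have h1 := hg.addCocycle_eq hγc hγpos hξ t x
  have h2 := hg.addCocycle_eq hγc hγpos (continuous_const (y := (1 : ℝ))) t x
  simp only [one_mul] at h2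
  have h3 : addCocycle g (fun _ => (1 : ℝ)) t x = t := by simp [addCocycle]
  simp only [Function.comp_apply, Pi.div_apply]
  rw [← h1, ← h2, h3, div_div_div_cancel_right₀ ht.ne', addCocycle, one_div, div_eq_inv_mul]
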